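/- arXiv:1202.1205 — 8 statements merged into one kernel-verified Lean document; each statement's English description precedes it below -/
import Mathlib

section
/- For every positive integer n and every real number x with cos x ≠ 0, the (2n-1)-th derivative of the tangent function at x equals (1/cos^{2n} x) · Σ_{i=0}^{n-1} a_{2n-1,2i} · cos(2 i x), where the coefficients a_{2n-1,2i} are given by the explicit formulas in the context. -/
open Finset

/-- The coefficients `a_{2n-1,2i}` in the expansion of the `(2n-1)`-th derivative of
the tangent function: `a_{1,0} = 1`;
`a_{2n-1,0} = 2n · Σ_{ℓ=0}^{n-2} (-1)^ℓ C(2n-1,ℓ) (n-ℓ-1)^{2n-2}` for `n > 1`;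
`a_{2n-1,2i} = 2 · Σ_{ℓ=0}^{n-i-1} (-1)^{i+ℓ} C(2n,ℓ) (n-i-ℓ)^{2n-1}` for `1 ≤ i ≤ n-1`. -/
noncomputable def aodd (n i : ℕ) : ℝ :=
  if i = 0 then
    if n = 1 then 1
    else 2 * n * ∑ l ∈ Finset.range (n - 1),
      (-1 : ℝ) ^ l * (Nat.choose (2 * n - 1) l : ℝ) * ((n : ℝ) - l - 1) ^ (2 * n - 2)
  else 2 * ∑ l ∈ Finset.range (n - i),
    (-1 : ℝ) ^ (i + l) * (Nat.choose (2 * n) l : ℝ) * ((n : ℝ) - i - l) ^ (2 * n - 1)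

/-- The Eulerian numbers `A(m, k)`, with `A(0, 0) = 1`, as real numbers. -/
def eulerianNumber : ℕ → ℕ → ℝ
  | 0, 0 => 1
  | 0, _ + 1 => 0
  | m + 1, 0 => eulerianNumber m 0
  | m + 1, k + 1 =>
    ((k : ℝ) + 2) * eulerianNumber m (k + 1) + ((m : ℝ) - k) * eulerianNumber m k

lemma eulerianNumber_succ_succ (m k : ℕ) :
    eulerianNumber (m + 1) (k + 1) =
      ((k : ℝ) + 2) * eulerianNumber m (k + 1) + ((m : ℝ) - k) * eulerianNumber m k := rfl

lemma eulerianNumber_zero_right (m : ℕ) : eulerianNumber m 0 = 1 := by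
  induction m with
  | zero => rfl
  | succ m ih => exact ih

lemma eulerianNumber_eq_zero_of_lt {m k : ℕ} (h : m < k) : eulerianNumber m k = 0 := by
  induction m generalizing k with
  | zero =>
    obtain ⟨k, rfl⟩ := Nat.exists_eq_succ_of_ne_zero h.ne'
    rfl
  | succ m ih =>
    obtain ⟨k, rfl⟩ := Nat.exists_eq_succ_of_ne_zero (Nat.ne_zero_of_lt h)
    rw [Nat.succ_eq_add_one, eulerianNumber_succ_succ, ih (by omega), ih (by omega)]
    ring

lemma eulerianNumber_succ_self (m : ℕ) : eulerianNumber (m + 1) (m + 1) = 0 := by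
  rw [eulerianNumber_succ_succ, eulerianNumber_eq_zero_of_lt (Nat.lt_succ_self m)]
  ring

lemma eulerianNumber_succ_pred (m : ℕ) : eulerianNumber (m + 1) m = 1 := by
  induction m with
  | zero => rfl
  | succ m ih =>
    rw [eulerianNumber_succ_succ, eulerianNumber_succ_self, ih]
    push_cast
    ring

lemma eulerianNumber_symm (a b : ℕ) :
    eulerianNumber (a + b + 1) a = eulerianNumber (a + b + 1) b := by
  induction h : a + b generalizing a b with
  | zero =>
    obtain ⟨rfl, rfl⟩ := Nat.add_eq_zero_iff.mp h
    rfl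
  | succ s ih =>
    rcases a with _ | a
    · obtain rfl : b = s + 1 := by omega
      rw [eulerianNumber_zero_right, eulerianNumber_succ_pred]
    rcases b with _ | b
    · obtain rfl : a = s := by omega
      rw [eulerianNumber_zero_right, eulerianNumber_succ_pred]
    rw [eulerianNumber_succ_succ _ a, eulerianNumber_succ_succ _ b, ih (a + 1) b (by omega),
      ih a (b + 1) (by omega)]
    have hs : (s : ℝ) = a + b + 1 := by
      norm_cast
      omega
    rw [Nat.cast_succ, hs]
    ring

/-- The alternating sum formula for the Eulerian numbers. -/
lemma eulerianNumber_eq_sum (m k : ℕ) :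
    eulerianNumber m k =
      ∑ l ∈ range (k + 1), (-1 : ℝ) ^ l * ((m + 1).choose l : ℝ) * ((k : ℝ) + 1 - l) ^ m := by
  induction m generalizing k with
  | zero =>
    rcases k with _ | k
    · simp [eulerianNumber]
    · rw [sum_range_succ', sum_range_succ']
      simp [eulerianNumber, Nat.choose_eq_zero_of_lt]
  | succ m ih =>
    rcases k with _ | k
    · simp [eulerianNumber_zero_right]
    · rw [eulerianNumber_succ_succ, ih, ih, sum_range_succ', sum_range_succ' _ (k + 1), mul_add,
        mul_sum, mul_sum, add_right_comm, ← sum_add_distrib]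
      congr 1
      · refine sum_congr rfl fun l _ => ?_
        have h₁ : ((m + 1 + 1).choose (l + 1) : ℝ) =
            (m + 1).choose l + (m + 1).choose (l + 1) := by
          rw [Nat.choose_succ_succ (m + 1) l]
          push_cast
          ring
        have h₂ : ((m + 1).choose (l + 1) : ℝ) * (l + 1) =
            (m + 1).choose l * ((m : ℝ) + 1 - l) := by
          rcases le_or_gt l (m + 1) with hl | hl
          · have := Nat.choose_succ_right_eq (m + 1) l
            rify [hl] at this
            exact this
          · simp [Nat.choose_eq_zero_of_lt hl, Nat.choose_eq_zero_of_lt (hl.trans l.lt_succ_self)]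
        rw [h₁]
        push_cast
        have h₃ : ((k : ℝ) + 1 + 1 - (l + 1)) = k + 1 - l := by ring
        rw [h₃]
        linear_combination -(-1 : ℝ) ^ l * ((k : ℝ) + 1 - l) ^ m * h₂
      · simp
        ring

lemma eulerianNumber_central (q : ℕ) :
    eulerianNumber (2 * q + 3) (q + 1) = 2 * ((q : ℝ) + 2) * eulerianNumber (2 * q + 2) q := by
  have h := eulerianNumber_symm (q + 1) q
  rw [show q + 1 + q + 1 = 2 * q + 2 by ring] at h
  rw [eulerianNumber_succ_succ, h]
  push_cast
  ring

/-- The numerator of the `m`-th derivative of `tan` over the denominator `cos ^ (m + 1)`. -/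
noncomputable def tanDerivNumerator (m : ℕ) (x : ℝ) : ℝ :=
  ∑ k ∈ range (m + 1), (-1 : ℝ) ^ (k + 1) * eulerianNumber m k *
    Real.cos ((2 * k + 1 - m) * x + (m + 1) * (Real.pi / 2))

lemma hasDerivAt_tanDerivNumerator (m : ℕ) (x : ℝ) :
    HasDerivAt (tanDerivNumerator m)
      (∑ k ∈ range (m + 1), (-1 : ℝ) ^ (k + 1) * eulerianNumber m k *
        (-Real.sin ((2 * k + 1 - m) * x + (m + 1) * (Real.pi / 2)) * (2 * k + 1 - m))) x := by
  refine HasDerivAt.fun_sum fun k _ => HasDerivAt.const_mul _ (HasDerivAt.cos ?_)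
  simpa using ((hasDerivAt_id x).const_mul ((2 * k + 1 - m : ℝ))).add_const
    (((m : ℝ) + 1) * (Real.pi / 2))

lemma tanDerivNumerator_succ (m : ℕ) (x : ℝ) :
    tanDerivNumerator (m + 1) x =
      (∑ k ∈ range (m + 1), (-1 : ℝ) ^ (k + 1) * eulerianNumber m k *
        (-Real.sin ((2 * k + 1 - m) * x + (m + 1) * (Real.pi / 2)) * (2 * k + 1 - m))) *
          Real.cos x + (m + 1) * Real.sin x * tanDerivNumerator m x := by
  set c : ℕ → ℝ := fun k =>
    Real.cos ((2 * k + 1 - (m + 1 : ℕ)) * x + ((m + 1 : ℕ) + 1) * (Real.pi / 2)) with hc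
  have h_term (k : ℕ) :
      -Real.sin ((2 * k + 1 - m) * x + (m + 1) * (Real.pi / 2)) * (2 * k + 1 - m) * Real.cos x +
        (m + 1) * Real.sin x * Real.cos ((2 * k + 1 - m) * x + (m + 1) * (Real.pi / 2)) =
      (k + 1) * c k - (m - k) * c (k + 1) := by
    have h₁ : c k = -Real.sin ((2 * k + 1 - m) * x + (m + 1) * (Real.pi / 2) - x) := by
      rw [hc, ← Real.cos_add_pi_div_two]
      push_cast
      ring_nf
    have h₂ : c (k + 1) = -Real.sin ((2 * k + 1 - m) * x + (m + 1) * (Real.pi / 2) + x) := by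
      rw [hc, ← Real.cos_add_pi_div_two]
      push_cast
      ring_nf
    rw [h₁, h₂]
    generalize (2 * k + 1 - m) * x + (m + 1) * (Real.pi / 2) = θ
    rw [Real.sin_sub, Real.sin_add]
    ring
  have h_rhs :
      (∑ k ∈ range (m + 1), (-1 : ℝ) ^ (k + 1) * eulerianNumber m k *
        (-Real.sin ((2 * k + 1 - m) * x + (m + 1) * (Real.pi / 2)) * (2 * k + 1 - m))) *
          Real.cos x + (m + 1) * Real.sin x * tanDerivNumerator m x =
      ∑ k ∈ range (m + 1), (-1 : ℝ) ^ (k + 1) * ((k + 1) * eulerianNumber m k) * c k +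
      ∑ k ∈ range (m + 1), (-1 : ℝ) ^ (k + 2) * ((m - k) * eulerianNumber m k) * c (k + 1) := by
    rw [tanDerivNumerator, sum_mul, mul_sum, ← sum_add_distrib, ← sum_add_distrib]
    refine sum_congr rfl fun k _ => ?_
    linear_combination (-1 : ℝ) ^ (k + 1) * eulerianNumber m k * h_term k
  have h_extend :
      ∑ k ∈ range (m + 1), (-1 : ℝ) ^ (k + 1) * ((k + 1) * eulerianNumber m k) * c k =
      ∑ k ∈ range (m + 2), (-1 : ℝ) ^ (k + 1) * ((k + 1) * eulerianNumber m k) * c k := by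
    rw [sum_range_succ _ (m + 1), eulerianNumber_eq_zero_of_lt (Nat.lt_succ_self m)]
    ring
  rw [h_rhs, h_extend, sum_range_succ' _ (m + 1), add_right_comm, ← sum_add_distrib,
    tanDerivNumerator, sum_range_succ']
  congr 1
  · refine sum_congr rfl fun k _ => ?_
    rw [eulerianNumber_succ_succ]
    push_cast
    simp only [hc]
    push_cast
    ring
  · simp [hc, eulerianNumber_zero_right]

/-- The `m`-th derivative of the tangent in terms of Eulerian numbers. -/
lemma iteratedDeriv_tan (m : ℕ) {x : ℝ} (hx : Real.cos x ≠ 0) :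
    iteratedDeriv m Real.tan x = tanDerivNumerator m x / Real.cos x ^ (m + 1) := by
  induction m generalizing x with
  | zero =>
    simp [tanDerivNumerator, eulerianNumber, Real.cos_add_pi_div_two, Real.tan_eq_sin_div_cos]
  | succ m ih =>
    have h_nhds : ∀ᶠ y in nhds x, Real.cos y ≠ 0 :=
      Real.continuous_cos.continuousAt.eventually_ne hx
    rw [iteratedDeriv_succ, Filter.EventuallyEq.deriv_eq (h_nhds.mono fun y hy => ih hy),
      ((hasDerivAt_tanDerivNumerator m x).fun_div ((Real.hasDerivAt_cos x).fun_pow (m + 1))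
        (pow_ne_zero _ hx)).deriv, tanDerivNumerator_succ]
    generalize (∑ k ∈ range (m + 1), _ : ℝ) = S
    push_cast
    field_simp
    ring

lemma sum_range_two_mul_add_one_eq_central {M : Type*} [AddCommMonoid M] (p : ℕ) (f : ℕ → M) :
    ∑ k ∈ range (2 * p + 1), f k = ∑ i ∈ range p, (f (p - 1 - i) + f (p + 1 + i)) + f p := by
  rw [show 2 * p + 1 = p + 1 + p by ring, sum_range_add, sum_range_succ, sum_add_distrib,
    sum_range_reflect, add_right_comm]

lemma aodd_zero (p : ℕ) : aodd (p + 1) 0 = eulerianNumber (2 * p + 1) p := by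
  rcases p with _ | q
  · simp [aodd, eulerianNumber]
  · rw [show 2 * (q + 1) + 1 = 2 * q + 3 by ring, eulerianNumber_central, eulerianNumber_eq_sum,
      aodd, if_pos rfl, if_neg (by omega), show q + 1 + 1 - 1 = q + 1 by omega,
      show 2 * (q + 1 + 1) - 1 = 2 * q + 2 + 1 by omega,
      show 2 * (q + 1 + 1) - 2 = 2 * q + 2 by omega]
    push_cast
    congr 1
    · ring
    · refine sum_congr rfl fun l _ => ?_
      congr 2
      ring

lemma aodd_succ {p i : ℕ} (hi : i < p) :
    aodd (p + 1) (i + 1) = 2 * ((-1) ^ (i + 1) * eulerianNumber (2 * p + 1) (p - 1 - i)) := by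
  obtain ⟨j, rfl⟩ := Nat.exists_eq_add_of_lt hi
  rw [aodd, if_neg (by omega), eulerianNumber_eq_sum,
    show i + j + 1 + 1 - (i + 1) = j + 1 by omega, show i + j + 1 - 1 - i = j by omega]
  simp only [mul_sum]
  refine sum_congr rfl fun l _ => ?_
  rw [show 2 * (i + j + 1 + 1) - 1 = 2 * (i + j + 1) + 1 by omega,
    show 2 * (i + j + 1 + 1) = 2 * (i + j + 1) + 1 + 1 by ring]
  push_cast
  rw [pow_add _ (i + 1) l, show (i : ℝ) + j + 1 + 1 - (i + 1) - l = j + 1 - l by ring]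
  ring

lemma tanDerivNumerator_odd (p : ℕ) (x : ℝ) :
    tanDerivNumerator (2 * p + 1) x =
      ∑ i ∈ range (p + 1), aodd (p + 1) i * Real.cos (2 * (i : ℝ) * x) := by
  have h_cos (k : ℕ) : Real.cos ((2 * k + 1 - (2 * p + 1 : ℕ)) * x +
      ((2 * p + 1 : ℕ) + 1) * (Real.pi / 2)) = (-1) ^ (p + 1) * Real.cos (2 * (k - p) * x) := by
    rw [← Real.cos_add_nat_mul_pi]
    push_cast
    ring_nf
  have h_sq (a : ℕ) : ((-1 : ℝ) ^ a) * (-1) ^ a = 1 := by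
    rw [← mul_pow]
    simp
  rw [tanDerivNumerator, sum_range_succ, eulerianNumber_succ_self,
    sum_range_two_mul_add_one_eq_central, sum_range_succ' _ p, aodd_zero]
  simp only [h_cos, mul_zero, zero_mul, add_zero]
  congr 1
  · refine sum_congr rfl fun i hi => ?_
    rw [aodd_succ (mem_range.mp hi)]
    obtain ⟨j, rfl⟩ := Nat.exists_eq_add_of_lt (mem_range.mp hi)
    rw [show i + j + 1 - 1 - i = j by omega]
    have h_symm := eulerianNumber_symm j (i + j + 1 + 1 + i)
    rw [show j + (i + j + 1 + 1 + i) + 1 = 2 * (i + j + 1) + 1 by ring] at h_symm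
    rw [← h_symm]
    push_cast
    rw [show 2 * ((j : ℝ) - (i + j + 1)) * x = -(2 * (i + 1) * x) by ring, Real.cos_neg,
      show 2 * ((i : ℝ) + j + 1 + 1 + i - (i + j + 1)) * x = 2 * (i + 1) * x by ring]
    have h₁ : (-1 : ℝ) ^ (j + 1) * (-1) ^ (i + j + 1 + 1) = (-1) ^ (i + 1) := by
      linear_combination (-1 : ℝ) ^ (i + 1) * h_sq (j + 1)
    have h₂ : (-1 : ℝ) ^ (i + j + 1 + 1 + i + 1) * (-1) ^ (i + j + 1 + 1) = (-1) ^ (i + 1) := by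
      linear_combination (-1 : ℝ) ^ (i + 1) * h_sq (i + j + 1 + 1)
    linear_combination eulerianNumber (2 * (i + j + 1) + 1) j * Real.cos (2 * (i + 1) * x) *
      (h₁ + h₂)
  · rw [sub_self]
    simp only [Nat.cast_zero, mul_zero, zero_mul, Real.cos_zero, mul_one]
    linear_combination eulerianNumber (2 * p + 1) p * h_sq (p + 1)

theorem tan_iteratedDeriv_odd (n : ℕ) (hn : 1 ≤ n) (x : ℝ) (hx : Real.cos x ≠ 0) :
    iteratedDeriv (2 * n - 1) Real.tan x =
      (1 / Real.cos x ^ (2 * n)) *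
        ∑ i ∈ Finset.range n, aodd n i * Real.cos (2 * (i : ℝ) * x) := by
  obtain ⟨p, rfl⟩ := Nat.exists_eq_add_of_le' hn
  rw [show 2 * (p + 1) - 1 = 2 * p + 1 by omega, iteratedDeriv_tan _ hx, tanDerivNumerator_odd,
    show 2 * (p + 1) = 2 * p + 1 + 1 by ring]
  ring
end

section
/- For every positive integer n and every real number x with cos x ≠ 0, the (2n)-th derivative of the tangent function at x equals (1/cos^{2n+1} x) · Σ_{i=0}^{n-1} a_{2n,2i+1} · sin((2i+1) x), where the coefficients a_{2n,2i+1} are given by the explicit formula in the context. -/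
open Finset

/-- The coefficients `a_{2n,2i+1}` in the expansion of the `(2n)`-th derivative of
the tangent function:
`a_{2n,2i+1} = 2 · Σ_{ℓ=0}^{n-i-1} (-1)^{i+ℓ} C(2n+1,ℓ) (n-i-ℓ)^{2n}` for `0 ≤ i ≤ n-1`. -/
noncomputable def aeven (n i : ℕ) : ℝ :=
  2 * ∑ l ∈ Finset.range (n - i),
    (-1 : ℝ) ^ (i + l) * (Nat.choose (2 * n + 1) l : ℝ) * ((n : ℝ) - i - l) ^ (2 * n)

/-- Eulerian numbers, shifted so that `eulerianReal m k` counts permutations of `m` letters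
with `k - 1` descents, given by their triangular recurrence. -/
noncomputable def eulerianReal : ℕ → ℕ → ℝ
  | 0, k => if k = 1 then 1 else 0
  | _ + 1, 0 => 0
  | m + 1, k + 1 =>
      ((k : ℝ) + 1) * eulerianReal m (k + 1) + ((m : ℝ) + 1 - k) * eulerianReal m k

theorem eulerianReal_zero_right (m : ℕ) : eulerianReal m 0 = 0 := by
  cases m <;> simp [eulerianReal]

theorem eulerianReal_eq_zero_of_lt {m k : ℕ} (h : m + 1 < k) : eulerianReal m k = 0 := by
  induction m generalizing k with
  | zero => simp [eulerianReal, show k ≠ 1 by omega]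
  | succ m ih =>
    obtain ⟨k, rfl⟩ := Nat.exists_eq_succ_of_ne_zero (show k ≠ 0 by omega)
    simp only [eulerianReal]
    rw [ih (by omega), ih (by omega)]
    ring

theorem eulerianReal_succ_last (m : ℕ) : eulerianReal (m + 1) (m + 2) = 0 := by
  simp only [eulerianReal]
  rw [eulerianReal_eq_zero_of_lt (by omega)]
  push_cast
  ring

theorem eulerianReal_symm {m k j : ℕ} (h : k + j = m + 2) :
    eulerianReal (m + 1) k = eulerianReal (m + 1) j := by
  induction m generalizing k j with
  | zero =>
    have hk : k ≤ 2 := by omega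
    interval_cases k
    · obtain rfl : j = 2 := by omega
      simp [eulerianReal]
    · obtain rfl : j = 1 := by omega
      rfl
    · obtain rfl : j = 0 := by omega
      simp [eulerianReal]
  | succ m ih =>
    rcases k with _ | k
    · obtain rfl : j = m + 1 + 2 := by omega
      rw [eulerianReal_succ_last, eulerianReal_zero_right]
    rcases j with _ | j
    · obtain rfl : k = m + 2 := by omega
      rw [eulerianReal_succ_last, eulerianReal_zero_right]
    rw [eulerianReal.eq_3 (m + 1) k, eulerianReal.eq_3 (m + 1) j,
      ih (show k + 1 + j = m + 2 by omega),
      ih (show k + (j + 1) = m + 2 by omega)]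
    have hm : (m : ℝ) = k + j - 1 := by
      rw [eq_sub_iff_add_eq]
      exact_mod_cast (show m + 1 = k + j by omega)
    push_cast
    rw [hm]
    ring

theorem eulerianReal_eq_sum (m k : ℕ) :
    eulerianReal m k =
      ∑ l ∈ range k, (-1 : ℝ) ^ l * ((m + 1).choose l : ℝ) * ((k : ℝ) - l) ^ m := by
  induction m generalizing k with
  | zero =>
    rcases k with _ | _ | k
    · simp [eulerianReal]
    · simp [eulerianReal]
    · rw [sum_range_succ', sum_range_succ', sum_eq_zero]
      · simp [eulerianReal]
      · intro l _
        simp [Nat.choose_eq_zero_of_lt (show 1 < l + 1 + 1 by omega)]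
  | succ m ih =>
    rcases k with _ | k
    · simp [eulerianReal]
    rw [eulerianReal, ih, ih, sum_range_succ', sum_range_succ', mul_add, mul_sum, mul_sum,
      add_right_comm, ← sum_add_distrib]
    congr 1
    · refine sum_congr rfl fun l _ => ?_
      have h₁ : ((m + 1 + 1 : ℕ) : ℝ) * ((m + 1).choose l : ℝ) =
          ((m + 1 + 1).choose (l + 1) : ℝ) * ((l + 1 : ℕ) : ℝ) := by
        exact_mod_cast Nat.add_one_mul_choose_eq (m + 1) l
      have h₂ : ((m + 1 + 1).choose (l + 1) : ℝ) =
          ((m + 1).choose l : ℝ) + ((m + 1).choose (l + 1) : ℝ) := by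
        exact_mod_cast Nat.choose_succ_succ (m + 1) l
      push_cast at h₁ ⊢
      rw [show (k : ℝ) + 1 - (l + 1) = k - l by ring, pow_succ ((k : ℝ) - l)]
      linear_combination (-1 : ℝ) ^ l * ((k : ℝ) - l) ^ m * (((k : ℝ) + 1) * h₂ + h₁)
    · push_cast
      simp
      ring

theorem hasDerivAt_cos_div_cos_pow (m k : ℕ) {x : ℝ} (hx : Real.cos x ≠ 0) :
    HasDerivAt
      (fun y => Real.cos ((2 * k - m - 1) * y + (m + 1) * (Real.pi / 2)) / Real.cos y ^ (m + 1))
      ((k * Real.cos ((2 * k - (m + 1 : ℕ) - 1) * x + ((m + 1 : ℕ) + 1) * (Real.pi / 2)) -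
        (m + 1 - k) * Real.cos ((2 * (k + 1 : ℕ) - (m + 1 : ℕ) - 1) * x +
          ((m + 1 : ℕ) + 1) * (Real.pi / 2))) / Real.cos x ^ (m + 2)) x := by
  have hθ : HasDerivAt (fun y : ℝ => (2 * k - m - 1) * y + (m + 1) * (Real.pi / 2))
      (2 * k - m - 1 : ℝ) x := by
    simpa using ((hasDerivAt_id x).const_mul (2 * k - m - 1 : ℝ)).add_const
      ((m + 1 : ℝ) * (Real.pi / 2))
  refine (hθ.cos.div ((Real.hasDerivAt_cos x).pow (m + 1)) (pow_ne_zero _ hx)).congr_deriv ?_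
  set θ : ℝ := (2 * k - m - 1) * x + (m + 1) * (Real.pi / 2) with hθ_def
  rw [show (2 * k - (m + 1 : ℕ) - 1) * x + ((m + 1 : ℕ) + 1) * (Real.pi / 2) =
      (θ - x) + Real.pi / 2 by push_cast; rw [hθ_def]; ring,
    show (2 * (k + 1 : ℕ) - (m + 1 : ℕ) - 1) * x + ((m + 1 : ℕ) + 1) * (Real.pi / 2) =
      (θ + x) + Real.pi / 2 by push_cast; rw [hθ_def]; ring,
    Real.cos_add_pi_div_two, Real.cos_add_pi_div_two]
  clear_value θ
  rw [Real.sin_add, Real.sin_sub]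
  simp only [Pi.pow_apply, Nat.add_sub_cancel]
  push_cast
  field_simp
  ring

theorem iteratedDeriv_tan_eq_sum (m : ℕ) {x : ℝ} (hx : Real.cos x ≠ 0) :
    iteratedDeriv m Real.tan x =
      ∑ k ∈ range (m + 2), (-1 : ℝ) ^ k * eulerianReal m k *
        (Real.cos ((2 * k - m - 1) * x + (m + 1) * (Real.pi / 2)) / Real.cos x ^ (m + 1)) := by
  induction m generalizing x with
  | zero =>
    simp only [iteratedDeriv_zero, sum_range_succ, range_zero, sum_empty, eulerianReal]
    norm_num [Real.cos_add_pi_div_two, Real.tan_eq_sin_div_cos]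
    ring
  | succ m ih =>
    have hev : iteratedDeriv m Real.tan =ᶠ[nhds x] fun y =>
        ∑ k ∈ range (m + 2), (-1 : ℝ) ^ k * eulerianReal m k *
          (Real.cos ((2 * k - m - 1) * y + (m + 1) * (Real.pi / 2)) / Real.cos y ^ (m + 1)) := by
      filter_upwards [Real.continuous_cos.continuousAt.eventually_ne hx] with y hy using ih hy
    rw [iteratedDeriv_succ, hev.deriv_eq, (HasDerivAt.fun_sum fun k _ =>
      (hasDerivAt_cos_div_cos_pow m k hx).const_mul _).deriv]
    set C : ℕ → ℝ := fun k => Real.cos ((2 * k - (m + 1 : ℕ) - 1) * x +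
      ((m + 1 : ℕ) + 1) * (Real.pi / 2)) / Real.cos x ^ (m + 2) with hC
    calc
      _ = ∑ k ∈ range (m + 2), ((-1 : ℝ) ^ k * eulerianReal m k * k * C k +
          (-1 : ℝ) ^ (k + 1) * eulerianReal m k * (m + 1 - k) * C (k + 1)) := by
        refine sum_congr rfl fun k _ => ?_
        simp only [hC]
        ring
      _ = ∑ k ∈ range (m + 2), ((-1 : ℝ) ^ (k + 1) * eulerianReal m (k + 1) * (k + 1 : ℕ) *
            C (k + 1) +
          (-1 : ℝ) ^ (k + 1) * eulerianReal m k * (m + 1 - k) * C (k + 1)) := by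
        rw [sum_add_distrib, sum_add_distrib]
        congr 1
        have h := sum_range_succ' (fun k => (-1 : ℝ) ^ k * eulerianReal m k * k * C k) (m + 2)
        rw [sum_range_succ, eulerianReal_eq_zero_of_lt (show m + 1 < m + 2 by omega)] at h
        simpa using h
      _ = ∑ k ∈ range (m + 1 + 2), (-1 : ℝ) ^ k * eulerianReal (m + 1) k * C k := by
        rw [sum_range_succ' _ (m + 2), eulerianReal_zero_right, mul_zero, zero_mul, add_zero]
        refine sum_congr rfl fun k _ => ?_
        rw [eulerianReal]
        push_cast
        ring

theorem aeven_eq_eulerianReal {n i : ℕ} (h : i ≤ n) :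
    aeven n i = 2 * ((-1) ^ i * eulerianReal (2 * n) (n - i)) := by
  rw [aeven, eulerianReal_eq_sum, Nat.cast_sub h]
  congr 1
  rw [mul_sum]
  refine sum_congr rfl fun l _ => ?_
  rw [pow_add]
  ring

theorem cos_add_odd_mul_pi_div_two (y : ℝ) (n : ℕ) :
    Real.cos (y + ((2 * n : ℕ) + 1) * (Real.pi / 2)) = -((-1) ^ n * Real.sin y) := by
  rw [show y + ((2 * n : ℕ) + 1) * (Real.pi / 2) = y + Real.pi / 2 + n * Real.pi by
    push_cast; ring, Real.cos_add_nat_mul_pi, Real.cos_add_pi_div_two]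
  ring

theorem tan_iteratedDeriv_even (n : ℕ) (hn : 1 ≤ n) (x : ℝ) (hx : Real.cos x ≠ 0) :
    iteratedDeriv (2 * n) Real.tan x =
      (1 / Real.cos x ^ (2 * n + 1)) *
        ∑ i ∈ Finset.range n, aeven n i * Real.sin ((2 * (i : ℝ) + 1) * x) := by
  rw [iteratedDeriv_tan_eq_sum _ hx, show 2 * n + 2 = (n + 1) + (n + 1) by ring, sum_range_add,
    ← sum_range_reflect, ← sum_add_distrib, sum_range_succ, mul_sum]
  have hsymm {i : ℕ} (hi : i ≤ n) :
      eulerianReal (2 * n) (n + 1 + i) = eulerianReal (2 * n) (n - i) := by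
    obtain ⟨p, rfl⟩ := Nat.exists_eq_add_of_le' hn
    exact eulerianReal_symm (m := 2 * p + 1) (by omega)
  rw [hsymm le_rfl, show n + 1 - 1 - n = 0 by omega, Nat.sub_self, eulerianReal_zero_right]
  simp only [mul_zero, zero_mul, add_zero]
  refine sum_congr rfl fun i hi => ?_
  have hin : i ≤ n := (mem_range.mp hi).le
  rw [hsymm hin, aeven_eq_eulerianReal hin, Nat.add_sub_cancel, cos_add_odd_mul_pi_div_two,
    cos_add_odd_mul_pi_div_two,
    show (2 * ((n - i : ℕ) : ℝ) - (2 * n : ℕ) - 1) * x = -((2 * i + 1) * x) by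
      rw [Nat.cast_sub hin]; push_cast; ring,
    show (2 * ((n + 1 + i : ℕ) : ℝ) - (2 * n : ℕ) - 1) * x = (2 * i + 1) * x by
      push_cast; ring,
    Real.sin_neg]
  obtain ⟨j, rfl⟩ := Nat.exists_eq_add_of_le hin
  have hsq (p : ℕ) : (-1 : ℝ) ^ p * (-1) ^ p = 1 := by rw [← mul_pow]; simp
  rw [Nat.add_sub_cancel_left]
  simp only [pow_add, pow_one]
  linear_combination (eulerianReal (2 * (i + j)) j * Real.sin ((2 * i + 1) * x) /
    Real.cos x ^ (2 * (i + j) + 1)) *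
      (2 * (-1) ^ i * hsq j + (-1) ^ i * (-1) ^ j * (-1) ^ j * hsq i)
end

section
/- For every positive integer n and every real number x with sin x ≠ 0, the (2n)-th derivative of the cotangent function at x equals (1/sin^{2n+1} x) · Σ_{i=0}^{n-1} (-1)^{i} · a_{2n,2i+1} · cos((2i+1) x), where the coefficients a_{2n,2i+1} are given by the explicit formula in the context. -/
open Finset

/-- The real cotangent function `cot x = cos x / sin x`. -/
noncomputable def cot (x : ℝ) : ℝ := Real.cos x / Real.sin x

/-- The Eulerian numbers, as real numbers: `eulerian m j` is the coefficient of `X ^ j` in the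
numerator of `∑ k, k ^ m * X ^ k = P / (1 - X) ^ (m + 1)`. -/
def eulerian : ℕ → ℕ → ℝ
  | 0, 0 => 1
  | 0, _ + 1 => 0
  | _ + 1, 0 => 0
  | m + 1, j + 1 => ((j : ℝ) + 1) * eulerian m (j + 1) + ((m : ℝ) + 1 - j) * eulerian m j

theorem eulerian_succ_zero (m : ℕ) : eulerian (m + 1) 0 = 0 := by
  rw [eulerian]

theorem eulerian_succ_succ (m j : ℕ) : eulerian (m + 1) (j + 1) =
    ((j : ℝ) + 1) * eulerian m (j + 1) + ((m : ℝ) + 1 - j) * eulerian m j := by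
  rw [eulerian]

theorem eulerian_eq_zero_of_lt {m j : ℕ} (h : m < j) : eulerian m j = 0 := by
  induction m generalizing j with
  | zero =>
    obtain ⟨j, rfl⟩ : ∃ k, j = k + 1 := ⟨j - 1, by omega⟩
    rfl
  | succ m ih =>
    obtain ⟨j, rfl⟩ : ∃ k, j = k + 1 := ⟨j - 1, by omega⟩
    rw [eulerian, ih (by omega), ih (by omega)]
    ring

theorem eulerian_symm {m j k : ℕ} (h : j + k = m + 2) :
    eulerian (m + 1) j = eulerian (m + 1) k := by
  induction m generalizing j k with
  | zero =>
    have hj : j ≤ 2 := by omega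
    obtain rfl : k = 2 - j := by omega
    interval_cases j <;> simp [eulerian]
  | succ m ih =>
    rcases j with _ | j
    · rw [eulerian, eulerian_eq_zero_of_lt (by omega)]
    rcases k with _ | k
    · rw [eulerian_succ_zero, eulerian_eq_zero_of_lt (by omega)]
    have hm : (m : ℝ) = j + k - 1 := by
      rw [eq_sub_iff_add_eq]
      exact_mod_cast (show m + 1 = j + k by omega)
    rw [eulerian_succ_succ (m + 1) j, eulerian_succ_succ (m + 1) k,
      ih (show (j + 1) + k = m + 2 by omega),
      ih (show j + (k + 1) = m + 2 by omega)]
    push_cast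
    rw [hm]
    ring

theorem eulerian_eq_sum (m j : ℕ) :
    eulerian m j =
      ∑ l ∈ range (j + 1), (-1 : ℝ) ^ l * ((m + 1).choose l : ℝ) * ((j : ℝ) - l) ^ m := by
  induction m generalizing j with
  | zero =>
    rcases j with _ | j
    · simp [eulerian]
    · rw [sum_range_succ', sum_range_succ']
      simp [eulerian, Nat.choose_eq_zero_of_lt]
  | succ m ih =>
    rcases j with _ | j
    · simp [eulerian]
    rw [eulerian, ih, ih, sum_range_succ' _ (j + 1), sum_range_succ' _ (j + 1), mul_add, mul_sum,
      mul_sum, add_right_comm, ← sum_add_distrib]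
    congr 1
    · refine sum_congr rfl fun l _ => ?_
      have hc : ((m + 1).choose (l + 1) : ℝ) * (l + 1) = (m + 1).choose l * ((m : ℝ) + 1 - l) := by
        rcases le_or_gt l (m + 1) with hl | hl
        · have := Nat.choose_succ_right_eq (m + 1) l
          rw [← @Nat.cast_inj ℝ] at this
          push_cast [Nat.cast_sub hl] at this
          exact this
        · simp [Nat.choose_eq_zero_of_lt hl, Nat.choose_eq_zero_of_lt (Nat.lt_succ_of_lt hl)]
      rw [Nat.choose_succ_succ' (m + 1) l]
      push_cast
      rw [show (j : ℝ) + 1 - (l + 1) = j - l by ring]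
      linear_combination (-1 : ℝ) ^ (l + 1) * ((j : ℝ) - l) ^ m * hc
    · push_cast
      simp
      ring

theorem sum_eulerian_succ (m : ℕ) (f : ℕ → ℝ) :
    ∑ j ∈ range (m + 2), eulerian (m + 1) j * f j =
      ∑ j ∈ range (m + 1), eulerian m j * (j * f j + ((m : ℝ) + 1 - j) * f (j + 1)) := by
  have hs : ∑ j ∈ range (m + 1), ((j : ℝ) + 1) * eulerian m (j + 1) * f (j + 1) =
      ∑ j ∈ range (m + 1), (j : ℝ) * eulerian m j * f j := by
    have h := sum_range_succ' (fun j : ℕ => (j : ℝ) * eulerian m j * f j) (m + 1)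
    rw [sum_range_succ, eulerian_eq_zero_of_lt (Nat.lt_succ_self m)] at h
    simpa using h.symm
  rw [sum_range_succ', eulerian, zero_mul, add_zero]
  simp only [eulerian, add_mul _ _ (f _), mul_add (eulerian m _), sum_add_distrib]
  rw [hs]
  congr 1 <;> exact sum_congr rfl fun j _ => by ring

theorem iteratedDeriv_cot (m : ℕ) (x : ℝ) (hx : Real.sin x ≠ 0) :
    iteratedDeriv m cot x =
      (-1) ^ m * (∑ j ∈ range (m + 1), eulerian m j * Real.cos ((2 * (j : ℝ) - m - 1) * x)) /
        Real.sin x ^ (m + 1) := by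
  induction m generalizing x with
  | zero => simp [eulerian, cot]
  | succ m ih =>
    have hev := (Real.continuous_sin.continuousAt.eventually_ne hx).mono ih
    rw [iteratedDeriv_succ, Filter.EventuallyEq.deriv_eq hev]
    have hS : HasDerivAt
        (fun y => ∑ j ∈ range (m + 1), eulerian m j * Real.cos ((2 * (j : ℝ) - m - 1) * y))
        (∑ j ∈ range (m + 1), eulerian m j *
          (-Real.sin ((2 * (j : ℝ) - m - 1) * x) * ((2 * (j : ℝ) - m - 1) * 1))) x :=
      HasDerivAt.fun_sum fun j _ => (((hasDerivAt_id' x).const_mul _).cos).const_mul _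
    rw [((hS.const_mul _).fun_div ((Real.hasDerivAt_sin x).fun_pow (m + 1))
      (pow_ne_zero _ hx)).deriv, sum_eulerian_succ]
    have key : (∑ j ∈ range (m + 1), eulerian m j *
          (-Real.sin ((2 * (j : ℝ) - m - 1) * x) * ((2 * (j : ℝ) - m - 1) * 1))) * Real.sin x -
        (m + 1) * Real.cos x *
          ∑ j ∈ range (m + 1), eulerian m j * Real.cos ((2 * (j : ℝ) - m - 1) * x) =
        -∑ j ∈ range (m + 1), eulerian m j *
          (j * Real.cos ((2 * (j : ℝ) - (m + 1 : ℕ) - 1) * x) +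
            ((m : ℝ) + 1 - j) * Real.cos ((2 * ((j + 1 : ℕ) : ℝ) - (m + 1 : ℕ) - 1) * x)) := by
      rw [sum_mul, mul_sum, ← sum_sub_distrib, ← sum_neg_distrib]
      refine sum_congr rfl fun j _ => ?_
      push_cast
      rw [show (2 * (j : ℝ) - (m + 1) - 1) * x = (2 * (j : ℝ) - m - 1) * x - x by ring,
        show (2 * ((j : ℝ) + 1) - (m + 1) - 1) * x = (2 * (j : ℝ) - m - 1) * x + x by ring,
        Real.cos_sub, Real.cos_add]
      ring
    rw [div_eq_div_iff (by positivity) (by positivity)]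
    push_cast at key ⊢
    linear_combination (-1 : ℝ) ^ m * Real.sin x ^ (2 * m + 2) * key

theorem aeven_eq_eulerian {n i : ℕ} (hi : i < n) :
    aeven n i = 2 * (-1) ^ i * eulerian (2 * n) (n - i) := by
  rw [aeven, eulerian_eq_sum, sum_range_succ, mul_assoc]
  have hn : 2 * n ≠ 0 := by omega
  simp only [sub_self, zero_pow hn, mul_zero, add_zero, mul_sum]
  refine sum_congr rfl fun l _ => ?_
  rw [Nat.cast_sub hi.le, pow_add]
  ring

theorem sum_eulerian_two_mul_cos {n : ℕ} (hn : 1 ≤ n) (x : ℝ) :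
    ∑ j ∈ range (2 * n + 1),
        eulerian (2 * n) j * Real.cos ((2 * (j : ℝ) - (2 * n : ℕ) - 1) * x) =
      ∑ i ∈ range n, 2 * eulerian (2 * n) (n - i) * Real.cos ((2 * (i : ℝ) + 1) * x) := by
  obtain ⟨m, hm⟩ : ∃ m, 2 * n = m + 1 := ⟨2 * n - 1, by omega⟩
  have h0 : eulerian (2 * n) 0 = 0 := by rw [hm, eulerian]
  rw [sum_range_succ', h0, zero_mul, add_zero, two_mul n, sum_range_add, ← two_mul,
    ← sum_range_reflect, ← sum_add_distrib]
  refine sum_congr rfl fun i hi => ?_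
  have hi := mem_range.1 hi
  have hsymm : eulerian (2 * n) (n + i + 1) = eulerian (2 * n) (n - i) := by
    rw [hm]
    exact eulerian_symm (by omega)
  rw [show n - 1 - i + 1 = n - i by omega, hsymm, Nat.cast_sub hi.le, ← Real.cos_neg]
  push_cast
  rw [show -((2 * ((n : ℝ) - i) - 2 * n - 1) * x) = (2 * (i : ℝ) + 1) * x by ring,
    show (2 * ((n : ℝ) + i + 1) - 2 * n - 1) * x = (2 * (i : ℝ) + 1) * x by ring]
  ring

theorem cot_iteratedDeriv_even (n : ℕ) (hn : 1 ≤ n) (x : ℝ) (hx : Real.sin x ≠ 0) :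
    iteratedDeriv (2 * n) cot x =
      (1 / Real.sin x ^ (2 * n + 1)) *
        ∑ i ∈ Finset.range n, (-1 : ℝ) ^ i * aeven n i * Real.cos ((2 * (i : ℝ) + 1) * x) := by
  rw [iteratedDeriv_cot _ _ hx, sum_eulerian_two_mul_cos hn, pow_mul, neg_one_sq, one_pow, one_mul,
    div_eq_mul_one_div, mul_comm]
  congr 1
  refine sum_congr rfl fun i hi => ?_
  rw [aeven_eq_eulerian (mem_range.1 hi)]
  have h : (-1 : ℝ) ^ i * (-1) ^ i = 1 := by rw [← mul_pow]; norm_num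
  linear_combination (-2 * eulerian (2 * n) (n - i) * Real.cos ((2 * (i : ℝ) + 1) * x)) * h
end

section
/- For every nonnegative integer n, every nonnegative integer i, and every real number x with cos x ≠ 0, the derivative of the function x ↦ sin((2i+1)x)/cos^{2n+1} x at x equals [ (n+1+i) · cos(2 i x) + (i - n) · cos(2(i+1) x) ] / cos^{2(n+1)} x. -/
theorem deriv_sin_div_cos_pow (n i : ℕ) (x : ℝ) (hx : Real.cos x ≠ 0) :
    deriv (fun y : ℝ => Real.sin ((2 * (i : ℝ) + 1) * y) / Real.cos y ^ (2 * n + 1)) x =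
      (((n : ℝ) + 1 + i) * Real.cos (2 * (i : ℝ) * x)
        + ((i : ℝ) - n) * Real.cos (2 * ((i : ℝ) + 1) * x)) / Real.cos x ^ (2 * (n + 1)) := by
  have hs : HasDerivAt (fun y : ℝ => Real.sin ((2 * (i : ℝ) + 1) * y))
      (Real.cos ((2 * (i : ℝ) + 1) * x) * ((2 * (i : ℝ) + 1) * 1)) x :=
    ((hasDerivAt_id x).const_mul (2 * (i : ℝ) + 1)).sin
  have hc : HasDerivAt (fun y : ℝ => Real.cos y ^ (2 * n + 1))
      (((2 * n + 1 : ℕ) : ℝ) * Real.cos x ^ (2 * n) * (-Real.sin x)) x :=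
    (Real.hasDerivAt_cos x).pow (2 * n + 1)
  have hsub : 2 * (i : ℝ) * x = (2 * (i : ℝ) + 1) * x - x := by ring
  have hadd : 2 * ((i : ℝ) + 1) * x = (2 * (i : ℝ) + 1) * x + x := by ring
  refine (hs.fun_div hc (pow_ne_zero _ hx)).deriv.trans ?_
  rw [hsub, hadd, Real.cos_sub, Real.cos_add, div_eq_div_iff (by positivity) (by positivity)]
  push_cast
  ring
end

section
/- For all positive integers n and i with 1 ≤ i ≤ n, the following binomial-sum identity holds: (n+1+i) · Σ_{ℓ=0}^{n-i-1} (-1)^ℓ · C(2n+1, ℓ) · (n-i-ℓ)^{2n} + (n+1-i) · Σ_{ℓ=0}^{n-i} (-1)^ℓ · C(2n+1, ℓ) · (n-i-ℓ+1)^{2n} = Σ_{ℓ=0}^{n-i} (-1)^ℓ · C(2n+2, ℓ) · (n-i-ℓ+1)^{2n+1} (for i = n the first sum is empty). -/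
open Finset

theorem binom_sum_identity_odd_step (n i : ℕ) (hi : 1 ≤ i) (hin : i ≤ n) :
    ((n : ℝ) + 1 + i) * ∑ l ∈ Finset.range (n - i),
        (-1 : ℝ) ^ l * (Nat.choose (2 * n + 1) l : ℝ) * ((n : ℝ) - i - l) ^ (2 * n)
      + ((n : ℝ) + 1 - i) * ∑ l ∈ Finset.range (n - i + 1),
        (-1 : ℝ) ^ l * (Nat.choose (2 * n + 1) l : ℝ) * ((n : ℝ) - i - l + 1) ^ (2 * n)
    = ∑ l ∈ Finset.range (n - i + 1),
        (-1 : ℝ) ^ l * (Nat.choose (2 * n + 2) l : ℝ) * ((n : ℝ) - i - l + 1) ^ (2 * n + 1) := by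
  rw [Finset.sum_range_succ' _ (n - i), Finset.sum_range_succ' _ (n - i), mul_add, ← add_assoc,
    Finset.mul_sum, Finset.mul_sum, ← Finset.sum_add_distrib]
  congr 1
  · refine Finset.sum_congr rfl fun l _ => ?_
    have absorb : ((2 * n + 1 : ℝ) + 1) * ((2 * n + 1).choose l : ℝ)
        = ((2 * n + 2).choose (l + 1) : ℝ) * (l + 1) := by
      exact_mod_cast Nat.add_one_mul_choose_eq (2 * n + 1) l
    have pascal : ((2 * n + 2).choose (l + 1) : ℝ)
        = (2 * n + 1).choose l + (2 * n + 1).choose (l + 1) := by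
      exact_mod_cast Nat.choose_succ_succ (2 * n + 1) l
    have shift : (n : ℝ) - i - ((l + 1 : ℕ) : ℝ) + 1 = n - i - l := by
      push_cast
      ring
    rw [shift, pow_succ _ l, pow_succ _ (2 * n)]
    linear_combination (-1 : ℝ) ^ l * ((n : ℝ) - i - l) ^ (2 * n) *
      (absorb + ((n : ℝ) + 1 - i) * pascal)
  · simp only [pow_zero, Nat.choose_zero_right, Nat.cast_zero, Nat.cast_one]
    ring
end

section
/- For all positive integers n and i with 1 ≤ i ≤ n-1, the following binomial-sum identity holds: (n+1-i) · Σ_{ℓ=0}^{n-i} (-1)^ℓ · C(2n+2, ℓ) · (n-i-ℓ+1)^{2n+1} + (n+2+i) · Σ_{ℓ=0}^{n-i-1} (-1)^ℓ · C(2n+2, ℓ) · (n-i-ℓ)^{2n+1} = Σ_{ℓ=0}^{n-i} (-1)^ℓ · C(2n+3, ℓ) · (n+1-i-ℓ)^{2n+2}. -/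
open Finset

theorem sum_range_alternating_choose_mul_pow_succ {R : Type*} [CommRing R] (N p m : ℕ) (x : R) :
    x * ∑ l ∈ Finset.range (m + 1), (-1) ^ l * (Nat.choose N l : R) * (x - l) ^ p
      + (N + 1 - x) * ∑ l ∈ Finset.range m, (-1) ^ l * (Nat.choose N l : R) * (x - 1 - l) ^ p
    = ∑ l ∈ Finset.range (m + 1),
        (-1) ^ l * (Nat.choose (N + 1) l : R) * (x - l) ^ (p + 1) := by
  induction m with
  | zero => simp [pow_succ']
  | succ m ih =>
    rw [Finset.sum_range_succ _ (m + 1),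
      Finset.sum_range_succ (fun l : ℕ => (-1) ^ l * (Nat.choose N l : R) * (x - 1 - l) ^ p) m,
      Finset.sum_range_succ _ (m + 1), ← ih, Nat.choose_succ_succ]
    have h : (Nat.choose N (m + 1) : R) * (m + 1) = Nat.choose N m * (N - m) := by
      rcases le_or_gt m N with hm | hm
      · have h := congrArg (Nat.cast (R := R)) (Nat.choose_succ_right_eq N m)
        push_cast [Nat.cast_sub hm] at h
        exact h
      · simp [Nat.choose_eq_zero_of_lt hm, Nat.choose_eq_zero_of_lt (hm.trans (Nat.lt_succ_self m))]
    have hx : x - 1 - (m : R) = x - ((m + 1 : ℕ) : R) := by push_cast; ring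
    rw [hx]
    generalize hy : (x - ((m + 1 : ℕ) : R)) ^ p = y
    rw [pow_succ (x - _) p, hy]
    push_cast
    linear_combination (-(-1) ^ m * y) * h

theorem binom_sum_identity_even_step (n i : ℕ) (hn : 1 ≤ n) (hi : 1 ≤ i) (hin : i ≤ n - 1) :
    ((n : ℝ) + 1 - i) * ∑ l ∈ Finset.range (n - i + 1),
        (-1 : ℝ) ^ l * (Nat.choose (2 * n + 2) l : ℝ) * ((n : ℝ) - i - l + 1) ^ (2 * n + 1)
      + ((n : ℝ) + 2 + i) * ∑ l ∈ Finset.range (n - i),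
        (-1 : ℝ) ^ l * (Nat.choose (2 * n + 2) l : ℝ) * ((n : ℝ) - i - l) ^ (2 * n + 1)
    = ∑ l ∈ Finset.range (n - i + 1),
        (-1 : ℝ) ^ l * (Nat.choose (2 * n + 3) l : ℝ) * ((n : ℝ) + 1 - i - l) ^ (2 * n + 2) := by
  have h := sum_range_alternating_choose_mul_pow_succ (2 * n + 2) (2 * n + 1) (n - i)
    ((n : ℝ) + 1 - i)
  convert h using 2
  · congr 1
    refine Finset.sum_congr rfl fun l _ => ?_
    ring
  · congr 1
    · push_cast
      ring
    · refine Finset.sum_congr rfl fun l _ => ?_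
      ring
end

section
/- For every positive integer n, the following binomial-sum identity holds: 2·(n+1) · [ 2·(n+1) · Σ_{ℓ=0}^{n-1} (-1)^ℓ · C(2n+1, ℓ) · (n-ℓ)^{2n} ] - (n+2) · [ 2 · Σ_{ℓ=0}^{n-1} (-1)^{1+ℓ} · C(2n+2, ℓ) · (n-ℓ)^{2n+1} ] = 2 · Σ_{ℓ=0}^{n} (-1)^ℓ · C(2n+3, ℓ) · (n+1-ℓ)^{2n+2}. -/
open Finset

/-- The explicit alternating sum for the Eulerian number with `k - 1` descents among the
permutations of `m` letters. -/
def eulerianSum (m k : ℕ) : ℝ :=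
  ∑ l ∈ range k, (-1 : ℝ) ^ l * (Nat.choose (m + 1) l : ℝ) * ((k : ℝ) - l) ^ m

theorem sum_alternating_choose_mul_sub_pow_eq_zero {j N : ℕ} (h : j < N) (x : ℝ) :
    ∑ l ∈ range (N + 1), (-1 : ℝ) ^ l * (Nat.choose N l : ℝ) * (x - l) ^ j = 0 := by
  have key := congr_fun (fwdDiff_iter_pow_eq_zero_of_lt (R := ℝ) h) (x - N)
  rw [fwdDiff_iter_eq_sum_shift, Pi.zero_apply] at key
  rw [← key, ← sum_flip]
  refine sum_congr rfl fun k hk => ?_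
  have hk' : k ≤ N := Nat.lt_succ_iff.mp (mem_range.mp hk)
  rw [Nat.choose_symm hk', Nat.cast_sub hk', zsmul_eq_mul]
  push_cast
  rw [nsmul_eq_mul, mul_one, sub_sub_eq_add_sub, sub_add_eq_add_sub]

theorem eulerianSum_succ_succ (m k : ℕ) :
    eulerianSum (m + 1) (k + 1)
      = ((k : ℝ) + 1) * eulerianSum m (k + 1) + ((m : ℝ) + 1 - k) * eulerianSum m k := by
  unfold eulerianSum
  rw [sum_range_succ', sum_range_succ' _ k, mul_add, mul_sum, mul_sum,
    add_right_comm (Finset.sum _ _), ← sum_add_distrib]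
  congr 1
  · refine sum_congr rfl fun l _ => ?_
    have pascal : ((m + 1 + 1).choose (l + 1) : ℝ)
        = (m + 1).choose l + (m + 1).choose (l + 1) := by
      exact_mod_cast Nat.choose_succ_succ (m + 1) l
    have absorb : ((m : ℝ) + 1 + 1) * (m + 1).choose l
        = ((m + 1).choose l + (m + 1).choose (l + 1)) * (l + 1) := by
      rw [← pascal]
      exact_mod_cast Nat.add_one_mul_choose_eq (m + 1) l
    rw [pascal]
    push_cast
    rw [show (k : ℝ) + 1 - (l + 1) = k - l by ring, pow_succ (-1 : ℝ), pow_succ _ m]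
    linear_combination -(-1 : ℝ) ^ l * ((k : ℝ) - l) ^ m * absorb
  · simp
    ring

theorem eulerianSum_two_mul_middle {n : ℕ} (hn : n ≠ 0) :
    eulerianSum (2 * n) (n + 1) = eulerianSum (2 * n) n := by
  have key := sum_alternating_choose_mul_sub_pow_eq_zero (Nat.lt_succ_self (2 * n)) ((n : ℝ) + 1)
  rw [show 2 * n + 1 + 1 = (n + 1) + (n + 1) by ring, sum_range_add] at key
  have upper : ∑ l ∈ range (n + 1), (-1 : ℝ) ^ (n + 1 + l) *
      (Nat.choose (2 * n + 1) (n + 1 + l) : ℝ) * ((n : ℝ) + 1 - (n + 1 + l : ℕ)) ^ (2 * n)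
      = -eulerianSum (2 * n) n := by
    rw [← sum_flip, sum_range_succ, eulerianSum, ← sum_neg_distrib]
    have last : ((n : ℝ) + 1 - (n + 1 + (n - n) : ℕ)) ^ (2 * n) = 0 := by
      simp [hn]
    rw [last, mul_zero, add_zero]
    refine sum_congr rfl fun l hl => ?_
    have hl' : l ≤ n := (mem_range.mp hl).le
    have hchoose : (2 * n + 1).choose (n + 1 + (n - l)) = (2 * n + 1).choose l :=
      Nat.choose_symm_of_eq_add (by lia)
    have hsign : (-1 : ℝ) ^ (n + 1 + (n - l)) = -(-1) ^ l := by
      have : (-1 : ℝ) ^ (n + 1 + (n - l)) * (-1) ^ l = -1 := by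
        rw [← pow_add, show n + 1 + (n - l) + l = 2 * n + 1 by lia]
        exact Odd.neg_one_pow ⟨n, rfl⟩
      rcases neg_one_pow_eq_or ℝ l with h | h <;> rw [h] at this ⊢ <;> linarith
    have hbase : (n : ℝ) + 1 - (n + 1 + (n - l) : ℕ) = -(n - l) := by
      push_cast [Nat.cast_sub hl']
      ring
    rw [hchoose, hsign, hbase, (even_two_mul n).neg_pow]
    ring
  rw [upper] at key
  unfold eulerianSum at key ⊢
  push_cast
  linarith

theorem binom_sum_identity_first_coeff (n : ℕ) (hn : 1 ≤ n) :
    2 * ((n : ℝ) + 1) * (2 * ((n : ℝ) + 1) * ∑ l ∈ Finset.range n,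
        (-1 : ℝ) ^ l * (Nat.choose (2 * n + 1) l : ℝ) * ((n : ℝ) - l) ^ (2 * n))
      - ((n : ℝ) + 2) * (2 * ∑ l ∈ Finset.range n,
        (-1 : ℝ) ^ (1 + l) * (Nat.choose (2 * n + 2) l : ℝ) * ((n : ℝ) - l) ^ (2 * n + 1))
    = 2 * ∑ l ∈ Finset.range (n + 1),
        (-1 : ℝ) ^ l * (Nat.choose (2 * n + 3) l : ℝ) * ((n : ℝ) + 1 - l) ^ (2 * n + 2) := by
  have hA : ∑ l ∈ range n, (-1 : ℝ) ^ l * (Nat.choose (2 * n + 1) l : ℝ) * ((n : ℝ) - l) ^ (2 * n)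
      = eulerianSum (2 * n) n := rfl
  have hB : ∑ l ∈ range n,
      (-1 : ℝ) ^ (1 + l) * (Nat.choose (2 * n + 2) l : ℝ) * ((n : ℝ) - l) ^ (2 * n + 1)
      = -eulerianSum (2 * n + 1) n := by
    simp [eulerianSum, pow_add]
  have hD : ∑ l ∈ range (n + 1),
      (-1 : ℝ) ^ l * (Nat.choose (2 * n + 3) l : ℝ) * ((n : ℝ) + 1 - l) ^ (2 * n + 2)
      = eulerianSum (2 * n + 1 + 1) (n + 1) := by
    simp [eulerianSum]
  rw [hA, hB, hD, eulerianSum_succ_succ (2 * n + 1), eulerianSum_succ_succ (2 * n),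
    eulerianSum_two_mul_middle (Nat.one_le_iff_ne_zero.mp hn)]
  push_cast
  ring
end

section
/- For every positive integer n and every real number x with cos x ≠ 0, the (2n+1)-th derivative of the tangent function at x, multiplied by cos^{2n+2} x and with all lower-frequency terms subtracted, has leading coefficient (-1)^{n}·2; precisely, tan^{(2n+1)}(x) · cos^{2n+2} x - Σ_{i=0}^{n-1} a_{2n+1,2i} · cos(2 i x) = (-1)^{n} · 2 · cos(2 n x), where a_{2n+1,0} = 2(n+1) · Σ_{ℓ=0}^{n-1} (-1)^ℓ · C(2n+1, ℓ) · (n-ℓ)^{2n} and a_{2n+1,2i} = 2 · Σ_{ℓ=0}^{n-i} (-1)^{i+ℓ} · C(2n+2, ℓ) · (n-i-ℓ+1)^{2n+1} for 1 ≤ i ≤ n-1. -/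
open Finset

/-- The coefficients `a_{2n+1,2i}` in the expansion of the `(2n+1)`-th derivative of
the tangent function:
`a_{2n+1,0} = 2(n+1) · Σ_{ℓ=0}^{n-1} (-1)^ℓ C(2n+1,ℓ) (n-ℓ)^{2n}` and
`a_{2n+1,2i} = 2 · Σ_{ℓ=0}^{n-i} (-1)^{i+ℓ} C(2n+2,ℓ) (n-i-ℓ+1)^{2n+1}` for `i ≥ 1`. -/
noncomputable def aoddc (n i : ℕ) : ℝ :=
  if i = 0 then
    2 * ((n : ℝ) + 1) * ∑ l ∈ Finset.range n,
      (-1 : ℝ) ^ l * (Nat.choose (2 * n + 1) l : ℝ) * ((n : ℝ) - l) ^ (2 * n)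
  else 2 * ∑ l ∈ Finset.range (n - i + 1),
    (-1 : ℝ) ^ (i + l) * (Nat.choose (2 * n + 2) l : ℝ) * ((n : ℝ) - i - l + 1) ^ (2 * n + 1)

/-- The Eulerian number `A(m + 1, k)`, indexed so that it is nonzero exactly for
`1 ≤ k ≤ m + 1`. -/
noncomputable def eulerianNum : ℕ → ℕ → ℝ
  | 0, k => if k = 1 then 1 else 0
  | _ + 1, 0 => 0
  | m + 1, k + 1 =>
    ((k : ℝ) + 1) * eulerianNum m (k + 1) + ((m : ℝ) + 2 - k) * eulerianNum m k

lemma eulerianNum_zero_right (m : ℕ) : eulerianNum m 0 = 0 := by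
  cases m <;> simp [eulerianNum]

lemma eulerianNum_eq_zero_of_le (m k : ℕ) (h : m + 2 ≤ k) : eulerianNum m k = 0 := by
  induction m generalizing k with
  | zero => simp [eulerianNum]; omega
  | succ m ih =>
    obtain ⟨k, rfl⟩ : ∃ j, k = j + 1 := ⟨k - 1, by omega⟩
    rw [eulerianNum, ih (k + 1) (by omega), ih k (by omega)]
    ring

lemma eulerianNum_symm (m i j : ℕ) (h : i + j = m + 2) : eulerianNum m i = eulerianNum m j := by
  induction m generalizing i j with
  | zero =>
    have : i = 1 ↔ j = 1 := by omega
    simp [eulerianNum, this]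
  | succ m ih =>
    rcases i with _ | i
    · rw [eulerianNum_zero_right, eulerianNum_eq_zero_of_le _ _ (by omega)]
    rcases j with _ | j
    · rw [eulerianNum_zero_right, eulerianNum_eq_zero_of_le _ _ (by omega)]
    have hm : (m : ℝ) = i + j - 1 := by
      have : (m : ℝ) + 1 = i + j := by exact_mod_cast (by omega : m + 1 = i + j)
      linarith
    rw [eulerianNum, eulerianNum, ih (i + 1) j (by omega), ih i (j + 1) (by omega), hm]
    ring

lemma eulerianNum_eq_sum (m k : ℕ) :
    eulerianNum m k = ∑ l ∈ Finset.range k,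
      (-1 : ℝ) ^ l * (Nat.choose (m + 2) l : ℝ) * ((k : ℝ) - l) ^ (m + 1) := by
  induction m generalizing k with
  | zero =>
    rcases k with _ | _ | k
    · simp [eulerianNum]
    · simp [eulerianNum]
    · have h0 : ∀ l ∈ Finset.range k, (-1 : ℝ) ^ (l + 1 + 1) * (Nat.choose (0 + 2) (l + 1 + 1) : ℝ) *
          (((k + 1 + 1 : ℕ) : ℝ) - (l + 1 + 1 : ℕ)) ^ (0 + 1) =
          if l = 0 then (k : ℝ) else 0 := by
        intro l _
        rcases l with _ | l
        · simp; ring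
        · simp [Nat.choose_eq_zero_of_lt]
      rw [Finset.sum_range_succ', Finset.sum_range_succ', Finset.sum_congr rfl h0]
      rcases k with _ | k
      · norm_num [eulerianNum]
      · simp [eulerianNum]
        ring
  | succ m ih =>
    rcases k with _ | k
    · simp [eulerianNum]
    · rw [eulerianNum, ih, ih, Finset.sum_range_succ', Finset.sum_range_succ', mul_add,
        Finset.mul_sum, Finset.mul_sum, add_right_comm, ← Finset.sum_add_distrib]
      congr 1
      · refine Finset.sum_congr rfl fun l _ => ?_
        have hc : (Nat.choose (m + 2) (l + 1) : ℝ) * ((l : ℝ) + 1) =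
            (Nat.choose (m + 2) l : ℝ) * ((m : ℝ) + 2 - l) := by
          rcases le_or_gt l (m + 2) with hl | hl
          · have := Nat.choose_succ_right_eq (m + 2) l
            have h2 : ((m + 2 - l : ℕ) : ℝ) = (m : ℝ) + 2 - l := by
              rw [Nat.cast_sub hl]; push_cast; ring
            rw [← h2]
            exact_mod_cast this
          · rw [Nat.choose_eq_zero_of_lt hl, Nat.choose_eq_zero_of_lt (by omega)]
            simp
        have hp : (Nat.choose (m + 1 + 2) (l + 1) : ℝ) =
            Nat.choose (m + 2) l + Nat.choose (m + 2) (l + 1) := by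
          exact_mod_cast Nat.choose_succ_succ (m + 2) l
        rw [hp]
        push_cast
        rw [show (k : ℝ) + 1 - (l + 1) = k - l by ring]
        linear_combination (-1 : ℝ) ^ l * (k - l : ℝ) ^ (m + 1) * (-1) * hc
      · simp
        ring

/-- The numerator of the `(m + 1)`-st derivative of `tan` over `cos ^ (m + 2)`. -/
noncomputable def tanDerivNum (m : ℕ) (x : ℝ) : ℝ :=
  ∑ k ∈ Finset.range (m + 2), (-1 : ℝ) ^ k * eulerianNum m k *
    Real.cos ((2 * (k : ℝ) - m - 2) * x + ((m : ℝ) + 2) * (Real.pi / 2))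

lemma hasDerivAt_tanDerivNum (m : ℕ) (x : ℝ) :
    HasDerivAt (tanDerivNum m) (∑ k ∈ Finset.range (m + 2), (-1 : ℝ) ^ k * eulerianNum m k *
      (-Real.sin ((2 * (k : ℝ) - m - 2) * x + ((m : ℝ) + 2) * (Real.pi / 2)) *
        (2 * (k : ℝ) - m - 2))) x := by
  unfold tanDerivNum
  refine HasDerivAt.fun_sum fun k _ => HasDerivAt.const_mul _ (HasDerivAt.cos ?_)
  simpa using ((hasDerivAt_id x).const_mul (2 * (k : ℝ) - m - 2)).add_const
    (((m : ℝ) + 2) * (Real.pi / 2))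

lemma tanDerivNum_succ (m : ℕ) (x : ℝ) :
    tanDerivNum (m + 1) x = (∑ k ∈ Finset.range (m + 2), (-1 : ℝ) ^ k * eulerianNum m k *
      (-Real.sin ((2 * (k : ℝ) - m - 2) * x + ((m : ℝ) + 2) * (Real.pi / 2)) *
        (2 * (k : ℝ) - m - 2))) * Real.cos x + (m + 2) * tanDerivNum m x * Real.sin x := by
  set θ : ℕ → ℝ := fun k => (2 * (k : ℝ) - m - 2) * x + ((m : ℝ) + 2) * (Real.pi / 2) with hθ
  have hdown : ∀ k : ℕ, Real.cos ((2 * (k : ℝ) - (m + 1 : ℕ) - 2) * x +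
      (((m + 1 : ℕ) : ℝ) + 2) * (Real.pi / 2)) = -Real.sin (θ k - x) := by
    intro k
    rw [← Real.cos_add_pi_div_two, hθ]
    congr 1
    push_cast
    ring
  have hup : ∀ k : ℕ, Real.sin (θ (k + 1) - x) = Real.sin (θ k + x) := by
    intro k
    congr 1
    simp only [hθ]
    push_cast
    ring
  have hshift : ∑ k ∈ Finset.range (m + 2),
      (-1 : ℝ) ^ (k + 1) * (((k : ℝ) + 1) * eulerianNum m (k + 1)) * -Real.sin (θ (k + 1) - x) =
      ∑ k ∈ Finset.range (m + 2),
        (-1 : ℝ) ^ k * ((k : ℝ) * eulerianNum m k) * -Real.sin (θ k - x) := by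
    have h1 := Finset.sum_range_succ (fun k : ℕ =>
      (-1 : ℝ) ^ k * ((k : ℝ) * eulerianNum m k) * -Real.sin (θ k - x)) (m + 2)
    rw [Finset.sum_range_succ'] at h1
    simpa [eulerianNum_eq_zero_of_le m (m + 2) le_rfl] using h1
  have hlhs : tanDerivNum (m + 1) x = ∑ k ∈ Finset.range (m + 2),
      ((-1 : ℝ) ^ (k + 1) * (((k : ℝ) + 1) * eulerianNum m (k + 1)) * -Real.sin (θ (k + 1) - x) +
      (-1 : ℝ) ^ (k + 1) * (((m : ℝ) + 2 - k) * eulerianNum m k) * -Real.sin (θ k + x)) := by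
    unfold tanDerivNum
    rw [Finset.sum_range_succ', eulerianNum_zero_right]
    simp only [mul_zero, zero_mul, add_zero]
    refine Finset.sum_congr rfl fun k _ => ?_
    rw [hdown, eulerianNum, hup]
    ring
  rw [hlhs, Finset.sum_add_distrib, hshift, ← Finset.sum_add_distrib, tanDerivNum,
    Finset.mul_sum, Finset.sum_mul, Finset.sum_mul, ← Finset.sum_add_distrib]
  refine Finset.sum_congr rfl fun k _ => ?_
  change _ = (-1 : ℝ) ^ k * eulerianNum m k * (-Real.sin (θ k) * (2 * (k : ℝ) - m - 2)) *
    Real.cos x + (m + 2) * ((-1 : ℝ) ^ k * eulerianNum m k * Real.cos (θ k)) * Real.sin x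
  rw [Real.sin_add, Real.sin_sub]
  ring

lemma iteratedDeriv_succ_tan (m : ℕ) (x : ℝ) (hx : Real.cos x ≠ 0) :
    iteratedDeriv (m + 1) Real.tan x = tanDerivNum m x / Real.cos x ^ (m + 2) := by
  induction m generalizing x with
  | zero =>
    have h : ((0 : ℕ) + 2 : ℝ) * (Real.pi / 2) = Real.pi := by push_cast; ring
    rw [zero_add, iteratedDeriv_one, Real.deriv_tan, tanDerivNum, zero_add,
      Finset.sum_range_succ, Finset.sum_range_one, h]
    simp [eulerianNum]
  | succ m ih =>
    have hev : iteratedDeriv (m + 1) Real.tan =ᶠ[nhds x]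
        fun y => tanDerivNum m y / Real.cos y ^ (m + 2) := by
      filter_upwards [Real.continuous_cos.continuousAt.eventually_ne hx] with y hy using ih y hy
    have hd := (hasDerivAt_tanDerivNum m x).fun_div ((Real.hasDerivAt_cos x).fun_pow (m + 2))
      (pow_ne_zero _ hx)
    rw [iteratedDeriv_succ, hev.deriv_eq, hd.deriv, tanDerivNum_succ]
    rw [div_eq_div_iff (by positivity) (by positivity)]
    simp only [show m + 2 - 1 = m + 1 by omega]
    push_cast
    ring

lemma sum_range_two_mul_add_one (f : ℕ → ℝ) (N : ℕ) :
    ∑ k ∈ Finset.range (2 * N + 1), f k =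
      f N + ∑ j ∈ Finset.range N, (f (N - 1 - j) + f (N + (j + 1))) := by
  rw [show 2 * N + 1 = N + (N + 1) by ring, Finset.sum_range_add, Finset.sum_range_succ',
    Finset.sum_add_distrib, Finset.sum_range_reflect]
  simp only [add_zero]
  ring

lemma tanDerivNum_two_mul (n : ℕ) (x : ℝ) :
    tanDerivNum (2 * n) x = eulerianNum (2 * n) (n + 1) +
      ∑ j ∈ Finset.range n, 2 * ((-1 : ℝ) ^ (j + 1) * eulerianNum (2 * n) (n - j)) *
        Real.cos (2 * ((j : ℝ) + 1) * x) := by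
  have hsq : ∀ k : ℕ, (-1 : ℝ) ^ k * (-1) ^ k = 1 := fun k => by rw [← mul_pow]; simp
  have hcos : ∀ k : ℕ, Real.cos ((2 * (k : ℝ) - (2 * n : ℕ) - 2) * x +
      (((2 * n : ℕ) : ℝ) + 2) * (Real.pi / 2)) =
      (-1) ^ (n + 1) * Real.cos (2 * ((k : ℝ) - n - 1) * x) := by
    intro k
    rw [← Real.cos_add_nat_mul_pi]
    congr 1
    push_cast
    ring
  have hext : tanDerivNum (2 * n) x = ∑ k ∈ Finset.range (2 * (n + 1) + 1),
      (-1 : ℝ) ^ k * eulerianNum (2 * n) k *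
        ((-1) ^ (n + 1) * Real.cos (2 * ((k : ℝ) - n - 1) * x)) := by
    rw [Finset.sum_range_succ, eulerianNum_eq_zero_of_le _ (2 * (n + 1)) (by omega), tanDerivNum]
    simp only [hcos, mul_zero, zero_mul, add_zero]
    rfl
  rw [hext, sum_range_two_mul_add_one, Finset.sum_range_succ]
  have hlast : eulerianNum (2 * n) (n + 1 + (n + 1)) = 0 :=
    eulerianNum_eq_zero_of_le _ _ (by omega)
  have hfirst : eulerianNum (2 * n) (n + 1 - 1 - n) = 0 := by
    simp [eulerianNum_zero_right]
  rw [hlast, hfirst]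
  simp only [mul_zero, zero_mul, add_zero]
  congr 1
  · push_cast
    rw [show 2 * ((n : ℝ) + 1 - n - 1) * x = 0 by ring, Real.cos_zero]
    linear_combination eulerianNum (2 * n) (n + 1) * hsq (n + 1)
  · refine Finset.sum_congr rfl fun j hj => ?_
    have hj' : j < n := Finset.mem_range.mp hj
    obtain ⟨p, rfl⟩ := Nat.exists_eq_add_of_lt hj'
    have e1 : j + p + 1 + 1 - 1 - j = p + 1 := by omega
    have e2 : j + p + 1 - j = p + 1 := by omega
    rw [eulerianNum_symm _ (j + p + 1 + 1 + (j + 1)) (p + 1) (by omega), e1, e2]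
    push_cast
    rw [show 2 * ((p : ℝ) + 1 - (j + p + 1) - 1) * x = -(2 * ((j : ℝ) + 1) * x) by ring,
      show 2 * ((j : ℝ) + p + 1 + 1 + (j + 1) - (j + p + 1) - 1) * x = 2 * ((j : ℝ) + 1) * x by ring,
      Real.cos_neg]
    linear_combination eulerianNum (2 * (j + p + 1)) (p + 1) * Real.cos (2 * ((j : ℝ) + 1) * x) *
      (-1) ^ (j + 1) * (hsq (p + 1) + hsq (j + p + 2))

lemma aoddc_zero_right (n : ℕ) (hn : 1 ≤ n) : aoddc n 0 = eulerianNum (2 * n) (n + 1) := by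
  obtain ⟨p, rfl⟩ : ∃ p, n = p + 1 := ⟨n - 1, by omega⟩
  have h := eulerianNum_eq_sum (2 * p + 1) (p + 1)
  have e : 2 * (p + 1) = 2 * p + 1 + 1 := by ring
  have hrec : eulerianNum (2 * p + 1 + 1) (p + 1 + 1) =
      (((p + 1 : ℕ) : ℝ) + 1) * eulerianNum (2 * p + 1) (p + 1 + 1) +
        (((2 * p + 1 : ℕ) : ℝ) + 2 - (p + 1 : ℕ)) * eulerianNum (2 * p + 1) (p + 1) := by
    rw [eulerianNum]
  rw [aoddc, if_pos rfl, e, ← h, hrec,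
    eulerianNum_symm (2 * p + 1) (p + 1 + 1) (p + 1) (by omega)]
  push_cast
  ring

lemma aoddc_succ_right (n j : ℕ) (hj : j < n) :
    aoddc n (j + 1) = 2 * ((-1 : ℝ) ^ (j + 1) * eulerianNum (2 * n) (n - j)) := by
  rw [aoddc, if_neg (by omega), eulerianNum_eq_sum, Finset.mul_sum (s := Finset.range (n - j)),
    show n - (j + 1) + 1 = n - j by omega, Nat.cast_sub hj.le]
  congr 1
  refine Finset.sum_congr rfl fun l _ => ?_
  push_cast
  rw [show (n : ℝ) - (j + 1) - l + 1 = n - j - l by ring]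
  ring

theorem tan_deriv_odd_leading_coeff (n : ℕ) (hn : 1 ≤ n) (x : ℝ) (hx : Real.cos x ≠ 0) :
    iteratedDeriv (2 * n + 1) Real.tan x * Real.cos x ^ (2 * n + 2)
      - ∑ i ∈ Finset.range n, aoddc n i * Real.cos (2 * (i : ℝ) * x)
    = (-1 : ℝ) ^ n * 2 * Real.cos (2 * (n : ℝ) * x) := by
  rw [iteratedDeriv_succ_tan _ _ hx, div_mul_cancel₀ _ (pow_ne_zero _ hx), tanDerivNum_two_mul]
  obtain ⟨p, rfl⟩ : ∃ p, n = p + 1 := ⟨n - 1, by omega⟩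
  have htop : eulerianNum (2 * (p + 1)) (p + 1 - p) = 1 := by
    rw [eulerianNum_eq_sum]
    simp
  rw [Finset.sum_range_succ' (fun i => aoddc _ i * _), Finset.sum_range_succ,
    aoddc_zero_right _ hn, htop]
  have hsum : ∀ j ∈ Finset.range p, aoddc (p + 1) (j + 1) * Real.cos (2 * ((j + 1 : ℕ) : ℝ) * x) =
      2 * ((-1 : ℝ) ^ (j + 1) * eulerianNum (2 * (p + 1)) (p + 1 - j)) *
        Real.cos (2 * ((j : ℝ) + 1) * x) := by
    intro j hj
    rw [aoddc_succ_right _ _ (by have := Finset.mem_range.mp hj; omega)]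
    push_cast
    rfl
  rw [Finset.sum_congr rfl hsum]
  push_cast
  simp only [mul_zero, zero_mul, Real.cos_zero]
  ring
end
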